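/- There is a constant C > 0 such that every finite simple graph G with maximum degree Δ and without isolated edges admits an adjacent vertex distinguishing edge colouring using at most Δ + C·Δ^(1/2)·(log Δ)^4 colours; that is, χ'_a(G) ≤ Δ + C·Δ^(1/2)·(log Δ)^4. -/

import Mathlib

namespace AVD

open Finset

section Vizing

variable {V E α : Type*}

/-- `c` is a proper edge colouring of the multigraph with edge set `F` and incidence map `ends`. -/
def Proper (ends : E → Sym2 V) (F : Finset E) (c : E → α) : Prop :=
  ∀ e ∈ F, ∀ f ∈ F, e ≠ f → ∀ v, v ∈ ends e → v ∈ ends f → c e ≠ c f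

/-- The colour `a` does not appear on the edges of `F` at `v`. -/
def Missing (ends : E → Sym2 V) (F : Finset E) (c : E → α) (v : V) (a : α) : Prop :=
  ∀ e ∈ F, v ∈ ends e → c e ≠ a

open Classical in
/-- The other end of the `a`-coloured edge at `v`, or `v` itself if there is none. -/
noncomputable def across (ends : E → Sym2 V) (F : Finset E) (c : E → α) (a : α) (v : V) : V :=
  if h : ∃ w, ∃ f ∈ F, ends f = s(v, w) ∧ c f = a then h.choose else v

/-- `f` is the last edge, with ends `x` and `z`, of a fan at `x` of length `n` that starts at the
edge `e₀` with ends `x` and `y₀`: each later edge has a colour missing at the far end of the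
previous one. -/
def Fan (ends : E → Sym2 V) (F : Finset E) (x : V) (e₀ : E) (y₀ : V) (c : E → α) :
    ℕ → E → V → Prop
  | 0, f, z => f = e₀ ∧ z = y₀
  | n + 1, f, z => ∃ e y, Fan ends F x e₀ y₀ c n e y ∧ f ∈ F ∧ ends f = s(x, z) ∧
      Missing ends F c y (c f)

variable {ends : E → Sym2 V} {F : Finset E} {c : E → α}

lemma across_eq (hc : Proper ends F c) {f : E} (hf : f ∈ F) {v w : V} (hfe : ends f = s(v, w)) :
    across ends F c (c f) v = w := by
  have h : ∃ w, ∃ g ∈ F, ends g = s(v, w) ∧ c g = c f := ⟨w, f, hf, hfe, rfl⟩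
  rw [across, dif_pos h]
  obtain ⟨g, hg, hge, hgc⟩ := h.choose_spec
  by_cases hgf : g = f
  · subst hgf
    rw [hfe] at hge
    exact (Sym2.congr_right.mp hge).symm
  · exact absurd hgc (hc g hg f hf hgf v (by simp [hge]) (by simp [hfe]))

lemma across_of_missing {v : V} {a : α} (h : Missing ends F c v a) :
    across ends F c a v = v := by
  rw [across, dif_neg]
  rintro ⟨w, f, hf, hfe, hfc⟩
  exact h f hf (by simp [hfe]) hfc

lemma across_involutive (hc : Proper ends F c) (a : α) :
    Function.Involutive (across ends F c a) := by
  intro v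
  by_cases h : ∃ w, ∃ f ∈ F, ends f = s(v, w) ∧ c f = a
  · obtain ⟨w, f, hf, hfe, rfl⟩ := h
    rw [across_eq hc hf hfe, across_eq hc hf (hfe.trans Sym2.eq_swap)]
  · have : across ends F c a v = v := by rw [across, dif_neg h]
    rw [this, this]

/-- In the dihedral action generated by two involutions, the orbit of a fixed point of the first
one contains at most one fixed point of the second one. -/
lemma fixed_unique_of_involutive {f g : V → V} (hf : Function.Involutive f)
    (hg : Function.Involutive g) {x : V} (hx : f x = x) :
    ∃ K : Set V, x ∈ K ∧ (∀ v, f v ∈ K ↔ v ∈ K) ∧ (∀ v, g v ∈ K ↔ v ∈ K) ∧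
      ∀ y ∈ K, ∀ z ∈ K, g y = y → g z = z → y = z := by
  set s := hf.toPerm with hs
  set t := hg.toPerm with ht
  have hss : s * s = 1 := by ext v; simp [hs, hf v]
  have htt : t * t = 1 := by ext v; simp [ht, hg v]
  have hsi : s⁻¹ = s := inv_eq_of_mul_eq_one_left hss
  have hti : t⁻¹ = t := inv_eq_of_mul_eq_one_left htt
  set T := t * s with hT
  have hconj : s * T * s⁻¹ = T⁻¹ := by
    rw [hT, mul_inv_rev, hsi, hti, mul_assoc, mul_assoc, hss, mul_one]
  have hsT : ∀ n : ℤ, s ((T ^ n) x) = (T ^ (-n)) x := by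
    intro n
    have h1 : s * T ^ n * s⁻¹ = T ^ (-n) := by
      rw [← conj_zpow, hconj, inv_zpow, zpow_neg]
    have h2 : s * T ^ n = T ^ (-n) * s := by rw [← h1]; simp
    have h3 := congrArg (fun p : Equiv.Perm V => p x) h2
    simp only [Equiv.Perm.mul_apply] at h3
    rw [h3]
    exact congrArg _ hx
  have htT : ∀ n : ℤ, t ((T ^ n) x) = (T ^ (1 - n)) x := by
    intro n
    have h1 : t = T * s := by rw [hT, mul_assoc, hss, mul_one]
    have h2 : t ((T ^ n) x) = T (s ((T ^ n) x)) := by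
      conv_lhs => rw [h1]
      rfl
    rw [h2, hsT, sub_eq_add_neg, zpow_add, zpow_one]
    rfl
  have key : ∀ n : ℤ, t ((T ^ n) x) = (T ^ n) x → (T ^ (2 * n - 1)) x = x := by
    intro n h
    rw [htT] at h
    have := congrArg (T ^ (n - 1)) h
    rw [← Equiv.Perm.mul_apply, ← Equiv.Perm.mul_apply, ← zpow_add, ← zpow_add] at this
    simp only [sub_add_sub_cancel', sub_self, zpow_zero, Equiv.Perm.one_apply] at this
    rw [show 2 * n - 1 = n - 1 + n by ring, ← this]
  have hmul : ∀ k : ℤ, (T ^ k) x = x → ∀ j : ℤ, (T ^ (j * k)) x = x := by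
    intro k hk j
    rw [mul_comm, zpow_mul]
    exact Equiv.Perm.zpow_apply_eq_self_of_apply_eq_self hk j
  refine ⟨{v | ∃ n : ℤ, (T ^ n) x = v}, ⟨0, rfl⟩, ?_, ?_, ?_⟩
  · have : ∀ v, (∃ n : ℤ, (T ^ n) x = v) → ∃ n : ℤ, (T ^ n) x = f v := by
      rintro _ ⟨n, rfl⟩
      exact ⟨-n, (hsT n).symm⟩
    exact fun v => ⟨fun h => by simpa [hf v] using this _ h, this v⟩
  · have : ∀ v, (∃ n : ℤ, (T ^ n) x = v) → ∃ n : ℤ, (T ^ n) x = g v := by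
      rintro _ ⟨n, rfl⟩
      exact ⟨1 - n, (htT n).symm⟩
    exact fun v => ⟨fun h => by simpa [hg v] using this _ h, this v⟩
  · rintro _ ⟨n, rfl⟩ _ ⟨m, rfl⟩ hy hz
    have h1 := key n hy
    have h2 := key m hz
    have h3 : (T ^ (n - m)) x = x := by
      rw [show n - m = (1 - m) * (2 * n - 1) + (n - 1) * (2 * m - 1) by ring, zpow_add,
        Equiv.Perm.mul_apply, hmul _ h2, hmul _ h1]
    rw [show n = m + (n - m) by ring, zpow_add, Equiv.Perm.mul_apply, h3]

lemma Proper.update [DecidableEq E] (hc : Proper ends F c) {f : E} {a : α}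
    (h : ∀ v ∈ ends f, Missing ends F c v a) :
    Proper ends (insert f F) (Function.update c f a) := by
  intro e he g hg heg v hve hvg
  rcases eq_or_ne e f with rfl | hef
  · have hge : g ≠ e := heg.symm
    rw [Function.update_self, Function.update_of_ne hge]
    exact (h v hve g ((mem_insert.mp hg).resolve_left hge) hvg).symm
  · have he' := (mem_insert.mp he).resolve_left hef
    rw [Function.update_of_ne hef]
    rcases eq_or_ne g f with rfl | hgf
    · rw [Function.update_self]
      exact h v hvg e he' hve
    · rw [Function.update_of_ne hgf]
      exact hc e he' g ((mem_insert.mp hg).resolve_left hgf) heg v hve hvg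

/-- If a colour is missing both at the centre of a fan and at the far end of one of its edges, then
the colouring can be changed and extended to the first edge of the fan. -/
lemma Fan.extend [DecidableEq E] {x y₀ : V} {e₀ : E} (he₀ : ends e₀ = s(x, y₀)) (n : ℕ) :
    ∀ (c : E → α) (a : α) (e : E) (y : V), Proper ends F c → Missing ends F c x a →
      Missing ends F c y a → Fan ends F x e₀ y₀ c n e y →
      ∃ c' : E → α, Proper ends (insert e₀ F) c' := by
  induction n using Nat.strong_induction_on with
  | _ n ih =>
  intro c a f z hc hx hz hfan
  cases n with
  | zero =>
    obtain ⟨rfl, rfl⟩ := hfan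
    refine ⟨_, hc.update (f := f) (a := a) fun v hv => ?_⟩
    rw [he₀, Sym2.mem_iff] at hv
    rcases hv with rfl | rfl
    exacts [hx, hz]
  | succ n =>
    by_cases hm : ∃ m ≤ n, Fan ends F x e₀ y₀ c m f z
    · obtain ⟨m, hmn, hm⟩ := hm
      exact ih m (by omega) c a f z hc hx hz hm
    obtain ⟨e, y, hey, hf, hfe, hmiss⟩ := hfan
    have hne : ∀ m ≤ n, ∀ g w, Fan ends F x e₀ y₀ c (m + 1) g w → m + 1 ≤ n → g ≠ f := by
      rintro m - g w hgw hmn rfl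
      obtain ⟨_, _, _, _, hge, _⟩ := id hgw
      rw [hfe] at hge
      exact hm ⟨m + 1, hmn, by rwa [Sym2.congr_right.mp hge]⟩
    set c' := Function.update c f a with hc'
    have hcf : ∀ g, g ≠ f → c' g = c g := fun g hg => Function.update_of_ne hg _ _
    have hcf' : c' f = a := Function.update_self _ _ _
    have hmiss' : ∀ v b, b ≠ a → Missing ends F c v b → Missing ends F c' v b := by
      intro v b hb h g hg hvg
      rcases eq_or_ne g f with rfl | hgf
      · rw [hcf']; exact hb.symm
      · rw [hcf g hgf]; exact h g hg hvg
    have hfan' : ∀ m ≤ n, ∀ g w, Fan ends F x e₀ y₀ c m g w → Fan ends F x e₀ y₀ c' m g w := by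
      intro m
      induction m with
      | zero => exact fun _ g w h => h
      | succ m ihm =>
        intro hmn g w hgw
        have hgf := hne m (by omega) g w hgw hmn
        obtain ⟨e', y', h1, hg, hge, h2⟩ := hgw
        refine ⟨e', y', ihm (by omega) _ _ h1, hg, hge, ?_⟩
        rw [hcf g hgf]
        exact hmiss' _ _ (hx g hg (by simp [hge])) h2
    have hproper : Proper ends F c' := by
      have := hc.update (f := f) (a := a) fun v hv => by
        rw [hfe, Sym2.mem_iff] at hv
        rcases hv with rfl | rfl
        exacts [hx, hz]
      rwa [insert_eq_of_mem hf] at this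
    have hac : c f ≠ a := hx f hf (by simp [hfe])
    refine ih n (by omega) c' (c f) e y hproper ?_ (hmiss' _ _ hac hmiss) (hfan' n le_rfl _ _ hey)
    intro g hg hxg
    rcases eq_or_ne g f with rfl | hgf
    · rw [hcf']; exact hac.symm
    · rw [hcf g hgf]; exact hc g hg f hf hgf x hxg (by simp [hfe])

/-- Kempe change: if the set `K` contains the centre of a fan and is closed under the edges of the
colours `a` and `b`, where `a` is missing at the centre and `b` at the far end of an edge of the fan
that lies outside `K`, then the colouring can be changed and extended. -/
lemma Fan.extend_of_not_mem [DecidableEq E] {x y₀ : V} {e₀ : E} (he₀ : ends e₀ = s(x, y₀))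
    (hc : Proper ends F c) {a b : α} (hx : Missing ends F c x a) {K : Set V} (hxK : x ∈ K)
    (ha : ∀ v, across ends F c a v ∈ K ↔ v ∈ K) (hb : ∀ v, across ends F c b v ∈ K ↔ v ∈ K)
    {n : ℕ} {e : E} {y : V} (hfan : Fan ends F x e₀ y₀ c n e y) (hy : Missing ends F c y b)
    (hyK : y ∉ K) : ∃ c' : E → α, Proper ends (insert e₀ F) c' := by
  classical
  have hex : ∃ n e y, Fan ends F x e₀ y₀ c n e y ∧ Missing ends F c y b ∧ y ∉ K :=
    ⟨n, e, y, hfan, hy, hyK⟩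
  obtain ⟨e, y, hfan, hy, hyK⟩ := Nat.find_spec hex
  have hmin := fun m (hm : m < Nat.find hex) => Nat.find_min hex hm
  set N := Nat.find hex
  set c' : E → α := fun f => if ∃ v ∈ ends f, v ∈ K then c f else Equiv.swap a b (c f) with hc'
  have hcol : ∀ f ∈ F, ∀ v ∈ ends f, c' f = if v ∈ K then c f else Equiv.swap a b (c f) := by
    intro f hf v hv
    by_cases hvK : v ∈ K
    · rw [if_pos hvK, hc']
      exact if_pos ⟨v, hv, hvK⟩
    rw [if_neg hvK]
    by_cases h : ∃ v ∈ ends f, v ∈ K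
    · have : c' f = c f := if_pos h
      rw [this, Equiv.swap_apply_of_ne_of_ne]
      all_goals
        intro hcf
        obtain ⟨w, hw, hwK⟩ := h
        have hvw : ends f = s(v, w) :=
          ((Sym2.mem_and_mem_iff (fun hvw => hvK (by rw [hvw]; exact hwK))).mp ⟨hv, hw⟩)
        have := across_eq hc hf hvw
        rw [hcf] at this
      · exact hvK ((ha v).mp (this ▸ hwK))
      · exact hvK ((hb v).mp (this ▸ hwK))
    · exact if_neg h
  have hproper : Proper ends F c' := by
    intro f hf g hg hfg v hvf hvg
    have := hc f hf g hg hfg v hvf hvg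
    rw [hcol f hf v hvf, hcol g hg v hvg]
    split_ifs
    · exact this
    · exact fun h => this ((Equiv.swap a b).injective h)
  have hfan' : ∀ m ≤ N, ∀ g w, Fan ends F x e₀ y₀ c m g w → Fan ends F x e₀ y₀ c' m g w := by
    intro m
    induction m with
    | zero => exact fun _ g w h => h
    | succ m ihm =>
      intro hmn g w hgw
      obtain ⟨e', y', h1, hg, hge, h2⟩ := hgw
      have hxg : x ∈ ends g := by simp [hge]
      refine ⟨e', y', ihm (by omega) _ _ h1, hg, hge, ?_⟩
      rw [hcol g hg x hxg, if_pos hxK]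
      intro h hh hyh
      rw [hcol h hh y' hyh]
      split_ifs with hyK'
      · exact h2 h hh hyh
      · have hga : c g ≠ a := hx g hg hxg
        have hgb : c g ≠ b := fun hgb => hmin m (by omega) ⟨e', y', h1, hgb ▸ h2, hyK'⟩
        intro hs
        rw [Equiv.swap_apply_eq_iff, Equiv.swap_apply_of_ne_of_ne hga hgb] at hs
        exact h2 h hh hyh hs
  refine Fan.extend he₀ N c' a e y hproper ?_ ?_ (hfan' N le_rfl _ _ hfan)
  · intro f hf hxf
    rw [hcol f hf x hxf, if_pos hxK]
    exact hx f hf hxf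
  · intro f hf hyf
    rw [hcol f hf y hyf, if_neg hyK]
    intro hs
    rw [Equiv.swap_apply_eq_iff, Equiv.swap_apply_left] at hs
    exact hy f hf hyf hs

end Vizing

section Vizing

variable {V E α : Type*} [DecidableEq V] {ends : E → Sym2 V} {F : Finset E} {c : E → α}

open Classical in
lemma card_le_card_missing [Fintype α] {D μ : ℕ} (hα : D + μ ≤ Fintype.card α)
    (v : V) {d : ℕ} (hd : (F.filter (v ∈ ends ·)).card ≤ d) (hdD : d ≤ D) :
    D + μ - d ≤ (univ.filter (Missing ends F c v)).card := by
  have h : univ ⊆ univ.filter (Missing ends F c v) ∪ (F.filter (v ∈ ends ·)).image c := by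
    intro b _
    by_cases hb : Missing ends F c v b
    · exact mem_union_left _ (by simpa using hb)
    · simp only [Missing, not_forall] at hb
      obtain ⟨f, hf, hvf, hfb⟩ := hb
      exact mem_union_right _ (mem_image.mpr ⟨f, by simp [hf, hvf], not_not.mp hfb⟩)
  have h1 := (card_le_card h).trans (card_union_le _ _)
  have h2 := card_image_le (s := F.filter (v ∈ ends ·)) (f := c)
  rw [card_univ] at h1
  omega

open Classical in
lemma Proper.exists_insert [Fintype V] [Fintype α] {D μ : ℕ} (hα : D + μ ≤ Fintype.card α)
    (hc : Proper ends F c) {e₀ : E} (he₀F : e₀ ∉ F)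
    (hdeg : ∀ v, ((insert e₀ F).filter (v ∈ ends ·)).card ≤ D)
    (hmult : ∀ z, ((insert e₀ F).filter (ends · = z)).card ≤ μ) :
    ∃ c' : E → α, Proper ends (insert e₀ F) c' := by
  by_contra hno
  obtain ⟨x, y₀, hxy⟩ : ∃ x y, ends e₀ = s(x, y) := by
    induction h : ends e₀ with | _ x y => exact ⟨x, y, rfl⟩
  have hdegF : ∀ v, (F.filter (v ∈ ends ·)).card ≤ D := fun v =>
    (card_le_card (filter_subset_filter _ (subset_insert _ _))).trans (hdeg v)
  have hdegF' : ∀ v ∈ ends e₀, (F.filter (v ∈ ends ·)).card + 1 ≤ D := by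
    intro v hv
    have := hdeg v
    rwa [filter_insert, if_pos hv, card_insert_of_notMem (by simp [he₀F])] at this
  have hmultF : ∀ z, (F.filter (ends · = z)).card ≤ μ := fun v =>
    (card_le_card (filter_subset_filter _ (subset_insert _ _))).trans (hmult v)
  obtain ⟨a, ha⟩ : ∃ a, Missing ends F c x a := by
    have h1 := hdegF' x (by simp [hxy])
    have h2 := card_le_card_missing (ends := ends) (F := F) (c := c) hα x (d := D - 1)
      (by omega) (by omega)
    have h3 : 0 < (univ.filter (Missing ends F c x)).card := by omega
    obtain ⟨a, ha⟩ := card_pos.mp h3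
    exact ⟨a, by simpa using ha⟩
  set Y : Finset V := univ.filter fun z => ∃ n f, Fan ends F x e₀ y₀ c n f z with hY
  have hy₀ : y₀ ∈ Y := by
    simp only [hY, mem_filter, mem_univ, true_and]
    exact ⟨0, e₀, rfl, rfl⟩
  have hdisj : (Y : Set V).PairwiseDisjoint fun z => univ.filter (Missing ends F c z) := by
    intro z hz w hw hzw
    simp only [hY, coe_filter, mem_univ, true_and, Set.mem_ofPred_eq] at hz hw
    obtain ⟨n, f, hf⟩ := hz
    obtain ⟨m, g, hg⟩ := hw
    refine Finset.disjoint_left.mpr fun b hbz hbw => hzw ?_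
    simp only [mem_filter, mem_univ, true_and] at hbz hbw
    obtain ⟨K, hxK, hKa, hKb, hK⟩ := fixed_unique_of_involutive (across_involutive hc a)
      (across_involutive hc b) (across_of_missing ha)
    refine hK z ?_ w ?_ (across_of_missing hbz) (across_of_missing hbw)
    · by_contra hzK
      exact hno (Fan.extend_of_not_mem hxy hc ha hxK hKa hKb hf hbz hzK)
    · by_contra hwK
      exact hno (Fan.extend_of_not_mem hxy hc ha hxK hKa hKb hg hbw hwK)
  have hsub : Y.biUnion (fun z => univ.filter (Missing ends F c z)) ⊆
      (Y.biUnion fun w => F.filter (ends · = s(x, w))).image c := by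
    intro b hb
    simp only [mem_biUnion, mem_filter, mem_univ, true_and, hY] at hb
    obtain ⟨z, ⟨n, e, he⟩, hbz⟩ := hb
    have hbx : ¬ Missing ends F c x b := fun hbx =>
      hno (Fan.extend hxy n c b e z hc hbx hbz he)
    simp only [Missing, not_forall, not_not] at hbx
    obtain ⟨f, hf, hxf, rfl⟩ := hbx
    obtain ⟨w, hw⟩ := hxf
    refine mem_image.mpr ⟨f, ?_, rfl⟩
    simp only [mem_biUnion, mem_filter, mem_univ, true_and, hY]
    exact ⟨w, ⟨n + 1, f, e, z, he, hf, hw, hbz⟩, hf, hw⟩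
  have hcard := ((card_le_card hsub).trans card_image_le).trans card_biUnion_le
  rw [card_biUnion hdisj] at hcard
  refine absurd hcard (not_le.mpr (sum_lt_sum (fun z _ => ?_) ⟨y₀, hy₀, ?_⟩))
  · have := card_le_card_missing (ends := ends) (F := F) (c := c) hα z (hdegF z) le_rfl
    have := hmultF s(x, z)
    omega
  · have h1 := hdegF' y₀ (by simp [hxy])
    have := card_le_card_missing (ends := ends) (F := F) (c := c) hα y₀ (d := D - 1)
      (by omega) (by omega)
    have := hmultF s(x, y₀)
    omega

/-- **Vizing's theorem** for multigraphs of maximum degree at most `D` and multiplicity at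
most `μ`. -/
theorem exists_proper [Fintype V] [Fintype α] [Nonempty α] (ends : E → Sym2 V) (F : Finset E)
    {D μ : ℕ} (hα : D + μ ≤ Fintype.card α)
    (hdeg : ∀ v, (F.filter (v ∈ ends ·)).card ≤ D)
    (hmult : ∀ z, (F.filter (ends · = z)).card ≤ μ) :
    ∃ c : E → α, Proper ends F c := by
  classical
  induction F using Finset.induction_on with
  | empty => exact ⟨fun _ => Classical.arbitrary α, by simp [Proper]⟩
  | insert e F he ih =>
    obtain ⟨c, hc⟩ := ih
      (fun v => (card_le_card (filter_subset_filter _ (subset_insert _ _))).trans (hdeg v))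
      (fun z => (card_le_card (filter_subset_filter _ (subset_insert _ _))).trans (hmult z))
    exact hc.exists_insert hα he hdeg hmult

/-- A version of `exists_proper` in which each colour determines the label of its edges. -/
lemma exists_proper_of_label [Fintype V] {ι : Type*} [Fintype ι] [DecidableEq ι]
    (ends : E → Sym2 V) (F : Finset E) (l : E → ι) (i₀ : ι) {D s μ : ℕ} (hμ : 0 < μ)
    (hD : ∀ v, (F.filter (v ∈ ends ·)).card ≤ D)
    (hs : ∀ i, i ≠ i₀ → ∀ v, (F.filter fun e => l e = i ∧ v ∈ ends e).card ≤ s)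
    (hmult : ∀ z, (F.filter (ends · = z)).card ≤ μ) :
    ∃ c : E → Fin (D + μ) ⊕ ι × Fin (s + μ), Proper ends F c ∧
      ∀ e ∈ F, Sum.elim (fun _ => i₀) Prod.fst (c e) = l e := by
  have : Nonempty (Fin (D + μ)) := ⟨⟨0, by omega⟩⟩
  have : Nonempty (Fin (s + μ)) := ⟨⟨0, by omega⟩⟩
  have hsub : ∀ i, F.filter (l · = i) ⊆ F := fun i => filter_subset _ _
  have hm : ∀ i z, ((F.filter (l · = i)).filter (ends · = z)).card ≤ μ := fun i z =>
    (card_le_card (filter_subset_filter _ (hsub i))).trans (hmult z)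
  obtain ⟨c₀, hc₀⟩ := exists_proper (α := Fin (D + μ)) ends (F.filter (l · = i₀)) (D := D) (μ := μ)
    (by simp) (fun v => (card_le_card (filter_subset_filter _ (hsub i₀))).trans (hD v)) (hm i₀)
  have hex : ∀ i, ∃ c : E → Fin (s + μ), i ≠ i₀ → Proper ends (F.filter (l · = i)) c := by
    intro i
    by_cases hi : i = i₀
    · exact ⟨fun _ => Classical.arbitrary _, fun h => absurd hi h⟩
    · obtain ⟨c, hc⟩ := exists_proper (α := Fin (s + μ)) ends (F.filter (l · = i)) (D := s) (μ := μ)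
        (by simp) (fun v => by rw [filter_filter]; exact hs i hi v) (hm i)
      exact ⟨c, fun _ => hc⟩
  choose c₁ hc₁ using hex
  refine ⟨fun e => if l e = i₀ then .inl (c₀ e) else .inr (l e, c₁ (l e) e), ?_, ?_⟩
  · intro e he f hf hef v hve hvf h
    dsimp only at h
    split_ifs at h with h₁ h₂ h₂
    · exact hc₀ e (by simp [he, h₁]) f (by simp [hf, h₂]) hef v hve hvf (Sum.inl_injective h)
    · have h := Sum.inr_injective h
      rw [Prod.mk.injEq] at h
      obtain ⟨h, h'⟩ := h
      rw [h] at h'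
      exact hc₁ (l f) h₂ e (by simp [he, h]) f (by simp [hf]) hef v hve hvf h'
  · intro e _
    dsimp only
    split_ifs with h
    · simp [h]
    · simp

end Vizing

section Weights

variable {V : Type*} [DecidableEq V]

lemma exists_enumeration {β : Type*} [DecidableEq β] (S : Finset β) :
    ∃ g : β → ℕ, S.image g = range S.card ∧ Set.InjOn g S := by
  have himg : ∃ g : β → ℕ, S.image g = range S.card := by
    refine ⟨fun e => if h : e ∈ S then (S.equivFin ⟨e, h⟩ : ℕ) else 0, ?_⟩
    ext i
    simp only [mem_image, mem_range]
    constructor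
    · rintro ⟨e, he, rfl⟩
      simp [he]
    · intro hi
      exact ⟨S.equivFin.symm ⟨i, hi⟩, (S.equivFin.symm ⟨i, hi⟩).2, by simp⟩
  obtain ⟨g, hg⟩ := himg
  exact ⟨g, hg, card_image_iff.mp (by rw [hg, card_range])⟩

/-- Every set `E` of edges has a subset that contains between about `1 / b` and about `2 / b` of the
edges at each vertex. -/
lemma exists_balanced_subset [Fintype V] (E : Finset (Sym2 V)) {b : ℕ} (hb : 0 < b) :
    ∃ H ⊆ E, ∀ v, (E.filter (v ∈ ·)).card / b ≤ (H.filter (v ∈ ·)).card ∧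
      (H.filter (v ∈ ·)).card ≤ 2 * ((E.filter (v ∈ ·)).card / b + 1) := by
  choose idx himg hinj using fun v : V => exists_enumeration (E.filter (v ∈ ·))
  have hlt : ∀ v, ∀ e ∈ E, v ∈ e → idx v e < (E.filter (v ∈ ·)).card := by
    intro v e he hv
    rw [← mem_range, ← himg]
    exact mem_image_of_mem _ (by simp [he, hv])
  set blk : V → Sym2 V → Fin (E.card + 1) := fun v e => Fin.ofNat _ (idx v e / b) with hblk
  have hblkv : ∀ v, ∀ e ∈ E, v ∈ e → (blk v e : ℕ) = idx v e / b := by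
    intro v e he hv
    refine Nat.mod_eq_of_lt (Nat.lt_succ_of_le ?_)
    exact (Nat.div_le_self _ _).trans ((hlt v e he hv).le.trans (card_filter_le _ _))
  set ends : Sym2 V → Sym2 (V × Fin (E.card + 1)) := fun e => Sym2.map (fun v => (v, blk v e)) e
    with hends
  have hmem : ∀ v i e, (v, i) ∈ ends e ↔ v ∈ e ∧ blk v e = i := by
    intro v i e
    simp only [hends, Sym2.mem_map, Prod.mk.injEq]
    constructor
    · rintro ⟨w, hw, rfl, rfl⟩
      exact ⟨hw, rfl⟩
    · rintro ⟨hv, rfl⟩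
      exact ⟨v, hv, rfl, rfl⟩
  obtain ⟨c, hc⟩ := exists_proper (α := Fin (b + 1)) ends E (D := b) (μ := 1) (by simp) (by
      rintro ⟨v, i⟩
      have : ((E.filter ((v, i) ∈ ends ·)).image (idx v)) ⊆ Ico (i * b) (i * b + b) := by
        intro j hj
        simp only [mem_image, mem_filter, hmem] at hj
        obtain ⟨e, ⟨he, hv, rfl⟩, rfl⟩ := hj
        rw [hblkv v e he hv, mem_Ico]
        exact ⟨Nat.div_mul_le_self _ _, Nat.lt_div_mul_add hb⟩
      have h1 := card_le_card this
      rw [card_image_of_injOn, Nat.card_Ico] at h1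
      · omega
      · refine (hinj v).mono fun e he => ?_
        simp only [coe_filter, Set.mem_ofPred_eq, hmem] at he ⊢
        exact ⟨he.1, he.2.1⟩) (by
      intro z
      refine card_le_one.mpr fun e he f hf => ?_
      have hfst : ∀ e, Sym2.map Prod.fst (ends e) = e := by
        intro e
        rw [hends, Sym2.map_map]
        exact congrFun Sym2.map_id' e
      rw [← hfst e, ← hfst f, (mem_filter.mp he).2, (mem_filter.mp hf).2])
  refine ⟨E.filter fun e => (c e : ℕ) < 2, filter_subset _ _, fun v => ⟨?_, ?_⟩⟩
  · have hex : ∀ i ∈ range ((E.filter (v ∈ ·)).card / b), ∃ e ∈ E, v ∈ e ∧ idx v e / b = i ∧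
        (c e : ℕ) < 2 := by
      intro i hi
      by_contra! hno
      set S := E.filter fun e => v ∈ e ∧ idx v e / b = i with hS
      have h1 : Ico (i * b) (i * b + b) ⊆ S.image (idx v) := by
        intro j hj
        rw [mem_Ico] at hj
        have hjb : j / b = i := by
          rw [Nat.div_eq_iff hb]
          omega
        have hjd : j ∈ range (E.filter (v ∈ ·)).card := by
          rw [mem_range] at hi ⊢
          have := (Nat.le_div_iff_mul_le hb).mp (Nat.succ_le_of_lt hi)
          rw [Nat.succ_mul] at this
          omega
        rw [← himg, mem_image] at hjd
        obtain ⟨e, he, rfl⟩ := hjd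
        rw [mem_filter] at he
        exact mem_image_of_mem _ (by simp [hS, he, hjb])
      have h2 : S.image (fun e => (c e : ℕ)) ⊆ Ico 2 (b + 1) := by
        intro j hj
        obtain ⟨e, he, rfl⟩ := mem_image.mp hj
        simp only [hS, mem_filter] at he
        exact mem_Ico.mpr ⟨hno e he.1 he.2.1 he.2.2, (c e).2⟩
      have h3 := (card_le_card h1).trans card_image_le
      have h4 := card_le_card h2
      rw [card_image_of_injOn, Nat.card_Ico] at h4
      · rw [Nat.card_Ico] at h3
        omega
      · intro e he f hf hef
        by_contra hne
        simp only [hS, coe_filter, Set.mem_ofPred_eq] at he hf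
        refine hc e he.1 f hf.1 hne (v, blk v e) (by simp [hmem, he.2.1]) ?_ (Fin.ext hef)
        rw [hmem]
        refine ⟨hf.2.1, Fin.ext ?_⟩
        rw [hblkv v e he.1 he.2.1, hblkv v f hf.1 hf.2.1, he.2.2, hf.2.2]
    have : Nonempty (Sym2 V) := ⟨s(v, v)⟩
    choose! g hgE hgv hgi hgc using hex
    rw [← card_range ((E.filter (v ∈ ·)).card / b)]
    refine card_le_card_of_injOn g (fun i hi => ?_) fun i hi j hj hij => ?_
    · simp only [coe_filter, mem_filter, Set.mem_ofPred_eq]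
      exact ⟨⟨hgE i hi, hgc i hi⟩, hgv i hi⟩
    · rw [← hgi i hi, ← hgi j hj, hij]
  · have : (range ((E.filter (v ∈ ·)).card / b + 1) ×ˢ range 2).card =
        2 * ((E.filter (v ∈ ·)).card / b + 1) := by
      rw [card_product, card_range, card_range, mul_comm]
    rw [← this]
    refine card_le_card_of_injOn (fun e => (idx v e / b, (c e : ℕ))) ?_ ?_
    · intro e he
      simp only [coe_filter, mem_filter, Set.mem_ofPred_eq] at he
      simp only [coe_product, Set.mem_prod, mem_coe, mem_range]
      exact ⟨Nat.lt_succ_of_le (Nat.div_le_div_right (hlt v e he.1.1 he.2).le), he.1.2⟩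
    · intro e he f hf hef
      simp only [coe_filter, mem_filter, Set.mem_ofPred_eq, Prod.mk.injEq] at he hf hef
      by_contra hne
      refine hc e he.1.1 f hf.1.1 hne (v, blk v e) (by simp [hmem, he.2]) ?_ (Fin.ext hef.2)
      rw [hmem]
      refine ⟨hf.2, Fin.ext ?_⟩
      rw [hblkv v e he.1.1 he.2, hblkv v f hf.1.1 hf.2, hef.1]

/-- The total weight of the edges of `H` at `v`. -/
def weightAt (H : Finset (Sym2 V)) (w : Sym2 V → ℕ) (v : V) : ℕ :=
  ∑ e ∈ H.filter (v ∈ ·), w e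

/-- The weights that may occur once the vertices of `P` have been processed: edges with an
unprocessed end can still be raised or lowered by one. -/
structure Admissible (H : Finset (Sym2 V)) (P : Finset V) (w : Sym2 V → ℕ) : Prop where
  le_three : ∀ e ∈ H, w e ≤ 3
  of_exists : ∀ e ∈ H, (∃ v ∈ e, v ∉ P) → 1 ≤ w e ∧ w e ≤ 2
  of_forall : ∀ e ∈ H, (∀ v ∈ e, v ∉ P) → w e = 1

lemma Admissible.process {H : Finset (Sym2 V)} {P : Finset V} {w : Sym2 V → ℕ}
    (hw : Admissible H P w) {v : V} (hv : v ∉ P) :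
    ∃ T : Finset ℕ, (H.filter (v ∈ ·)).card + 1 ≤ 2 * T.card ∧ ∀ t ∈ T, ∃ w',
      Admissible H (insert v P) w' ∧ weightAt H w' v / 2 = t ∧
      ∀ u ∈ P, weightAt H w' u / 2 = weightAt H w u / 2 := by
  classical
  set n := (H.filter (v ∈ ·)).card with hn
  set low : Sym2 V → ℕ := fun e =>
    if ∃ u ∈ P, u ∈ e ∧ weightAt H w u % 2 = 1 then w e - 1 else w e with hlow
  set L := ∑ e ∈ H.filter (v ∈ ·), low e with hL
  refine ⟨Icc (L / 2) ((L + n) / 2), by rw [Nat.card_Icc]; omega, fun t ht => ?_⟩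
  rw [mem_Icc] at ht
  obtain ⟨i, hin, hit⟩ : ∃ i ≤ n, (L + i) / 2 = t := ⟨max (2 * t) L - L, by omega, by omega⟩
  obtain ⟨A, hA, hAi⟩ := exists_subset_card_eq (hin.trans hn.le)
  set w' : Sym2 V → ℕ := fun e => if v ∈ e then low e + (if e ∈ A then 1 else 0) else w e with hw'
  have hlow_le : ∀ e, low e ≤ w e := by
    intro e
    simp only [hlow]
    split_ifs <;> omega
  refine ⟨w', ⟨?_, ?_, ?_⟩, ?_, ?_⟩
  · intro e he
    by_cases hve : v ∈ e
    · have h1 := (hw.of_exists e he ⟨v, hve, hv⟩).2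
      have h2 := hlow_le e
      simp only [hw', if_pos hve]
      split_ifs <;> omega
    · simpa only [hw', if_neg hve] using hw.le_three e he
  · rintro e he ⟨u, hu, huP⟩
    have hvu : v ≠ u := fun h => huP (h ▸ mem_insert_self _ _)
    have huP' : u ∉ P := fun h => huP (mem_insert_of_mem h)
    by_cases hve : v ∈ e
    · have hevu := (Sym2.mem_and_mem_iff hvu).mp ⟨hve, hu⟩
      have hnot : ∀ x ∈ e, x ∉ P := by
        intro x hx
        rw [hevu, Sym2.mem_iff] at hx
        rcases hx with rfl | rfl
        exacts [hv, huP']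
      have h1 : low e = 1 := by
        simp only [hlow]
        rw [if_neg, hw.of_forall e he hnot]
        rintro ⟨x, hxP, hx, -⟩
        exact hnot x hx hxP
      simp only [hw', if_pos hve, h1]
      split_ifs <;> omega
    · simpa only [hw', if_neg hve] using hw.of_exists e he ⟨u, hu, huP'⟩
  · intro e he hall
    have hve : v ∉ e := fun h => hall v h (mem_insert_self _ _)
    simp only [hw', if_neg hve]
    exact hw.of_forall e he fun x hx hxP => hall x hx (mem_insert_of_mem hxP)
  · have : weightAt H w' v = L + i := by
      have hsum : ∑ e ∈ A, 1 = ∑ e ∈ H.filter (v ∈ ·), if e ∈ A then 1 else 0 :=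
        sum_subset_zero_on_sdiff hA (fun e he => if_neg (mem_sdiff.mp he).2)
          fun e he => (if_pos he).symm
      rw [weightAt, hL, ← hAi, card_eq_sum_ones, hsum, ← sum_add_distrib]
      exact sum_congr rfl fun e he => if_pos (mem_filter.mp he).2
    rw [this, hit]
  · intro u hu
    have huv : v ≠ u := fun h => hv (h ▸ hu)
    by_cases he : s(v, u) ∈ H
    · have hmem : s(v, u) ∈ H.filter (u ∈ ·) := by simp [he]
      have hrest : ∑ e ∈ (H.filter (u ∈ ·)).erase s(v, u), w' e =
          ∑ e ∈ (H.filter (u ∈ ·)).erase s(v, u), w e := by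
        refine sum_congr rfl fun e he' => if_neg fun hve => ?_
        rw [mem_erase, mem_filter] at he'
        exact he'.1 ((Sym2.mem_and_mem_iff huv).mp ⟨hve, he'.2.2⟩)
      have h1 : weightAt H w' u = _ := (add_sum_erase _ w' hmem).symm
      have h2 : weightAt H w u = _ := (add_sum_erase _ w hmem).symm
      rw [hrest] at h1
      have h3 := hw.of_exists _ he ⟨v, by simp, hv⟩
      have h4 : low s(v, u) = if weightAt H w u % 2 = 1 then w s(v, u) - 1 else w s(v, u) := by
        simp only [hlow]
        congr 1
        simp only [Sym2.mem_iff, eq_iff_iff]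
        constructor
        · rintro ⟨x, hx, rfl | rfl, hodd⟩
          exacts [absurd hx hv, hodd]
        · exact fun hodd => ⟨u, hu, Or.inr rfl, hodd⟩
      have h5 : w' s(v, u) = low s(v, u) + if s(v, u) ∈ A then 1 else 0 := if_pos (by simp)
      split_ifs at h4 h5 <;> omega
    · have : weightAt H w' u = weightAt H w u := by
        refine sum_congr rfl fun e he' => if_neg fun hve => ?_
        rw [mem_filter] at he'
        exact he ((Sym2.mem_and_mem_iff huv).mp ⟨hve, he'.2⟩ ▸ he'.1)
      rw [this]

/-- If the edge set `H` has large degree at the vertices of `P`, then two weightings of `H` with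
weights at most three distinguish all pairs of adjacent vertices in `P`. -/
lemma exists_weights [Fintype V] (G : SimpleGraph V) [DecidableRel G.Adj] {H : Finset (Sym2 V)}
    (P : Finset V)
    (hP : ∀ v ∈ P, 4 * G.degree v < ((H.filter (v ∈ ·)).card + 1) ^ 2) :
    ∃ w₁ w₂, Admissible H P w₁ ∧ Admissible H P w₂ ∧ ∀ u ∈ P, ∀ v ∈ P, G.Adj u v →
      (weightAt H w₁ u / 2, weightAt H w₂ u / 2) ≠ (weightAt H w₁ v / 2, weightAt H w₂ v / 2) := by
  induction P using Finset.induction_on with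
  | empty =>
    have : Admissible H ∅ fun _ => 1 := ⟨by simp, by simp, by simp⟩
    exact ⟨_, _, this, this, by simp⟩
  | insert v P hv ih =>
    obtain ⟨w₁, w₂, h₁, h₂, hdist⟩ := ih fun u hu => hP u (mem_insert_of_mem hu)
    obtain ⟨T₁, hT₁, hw₁⟩ := h₁.process hv
    obtain ⟨T₂, hT₂, hw₂⟩ := h₂.process hv
    set B := (G.neighborFinset v).image fun u => (weightAt H w₁ u / 2, weightAt H w₂ u / 2) with hB
    have hcard : B.card < (T₁ ×ˢ T₂).card := by
      have h1 : B.card ≤ G.degree v := card_image_le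
      have h2 := hP v (mem_insert_self _ _)
      rw [card_product]
      have h3 := Nat.mul_le_mul hT₁ hT₂
      nlinarith
    obtain ⟨⟨t₁, t₂⟩, ht, htB⟩ := exists_mem_notMem_of_card_lt_card hcard
    rw [mem_product] at ht
    obtain ⟨w₁', a₁, b₁, c₁⟩ := hw₁ t₁ ht.1
    obtain ⟨w₂', a₂, b₂, c₂⟩ := hw₂ t₂ ht.2
    refine ⟨w₁', w₂', a₁, a₂, ?_⟩
    have hnew : ∀ u ∈ P, G.Adj v u → (weightAt H w₁' u / 2, weightAt H w₂' u / 2) ≠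
        (weightAt H w₁' v / 2, weightAt H w₂' v / 2) := by
      intro u hu hvu h
      rw [b₁, b₂, c₁ u hu, c₂ u hu] at h
      exact htB (mem_image.mpr ⟨u, by simpa using hvu, h⟩)
    intro x hx y hy hxy
    rw [mem_insert] at hx hy
    rcases hx with rfl | hx <;> rcases hy with rfl | hy
    · exact absurd hxy (G.loopless.irrefl _)
    · exact (hnew y hy hxy).symm
    · exact hnew x hx hxy.symm
    · rw [c₁ x hx, c₂ x hx, c₁ y hy, c₂ y hy]
      exact hdist x hx y hy hxy

end Weights

section Contraction

variable {V : Type*} [DecidableEq V]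

/-- No two distinct edges of `M` meet. -/
def IsMatching (M : Finset (Sym2 V)) : Prop :=
  ∀ e ∈ M, ∀ f ∈ M, ∀ v, v ∈ e → v ∈ f → e = f

lemma exists_maximal_matching (L : Finset (Sym2 V)) :
    ∃ M ⊆ L, IsMatching M ∧ ∀ e ∈ L, ∃ f ∈ M, ∃ v, v ∈ e ∧ v ∈ f := by
  induction L using Finset.induction_on with
  | empty => exact ⟨∅, Subset.rfl, by simp [IsMatching], by simp⟩
  | insert e L _ ih =>
    obtain ⟨M, hML, hM, hmax⟩ := ih
    by_cases h : ∃ f ∈ M, ∃ v, v ∈ e ∧ v ∈ f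
    · refine ⟨M, hML.trans (subset_insert _ _), hM, fun g hg => ?_⟩
      obtain rfl | hg := mem_insert.1 hg
      exacts [h, hmax g hg]
    · refine ⟨insert e M, insert_subset_insert _ hML, ?_, fun g hg => ?_⟩
      · intro f hf g hg v hvf hvg
        obtain hf | hf := mem_insert.1 hf <;> obtain hg | hg := mem_insert.1 hg
        · exact hf.trans hg.symm
        · exact absurd ⟨g, hg, v, hf ▸ hvf, hvg⟩ h
        · exact absurd ⟨f, hf, v, hg ▸ hvg, hvf⟩ h
        · exact hM f hf g hg v hvf hvg
      · obtain rfl | hg := mem_insert.1 hg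
        · exact ⟨g, mem_insert_self _ _, g.out.1, g.out_fst_mem, g.out_fst_mem⟩
        · obtain ⟨f, hf, hfg⟩ := hmax g hg
          exact ⟨f, mem_insert_of_mem hf, hfg⟩

/-- The image of `v` in the graph obtained by contracting the edges of the matching `M`: the edge
of `M` that covers `v`, or else the diagonal pair at `v`. -/
noncomputable def contract (M : Finset (Sym2 V)) (v : V) : Sym2 V :=
  if h : ∃ e ∈ M, v ∈ e then h.choose else s(v, v)

lemma mem_contract (M : Finset (Sym2 V)) (v : V) : v ∈ contract M v := by
  unfold contract
  split_ifs with h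
  · exact h.choose_spec.2
  · simp

lemma IsMatching.contract_eq {M : Finset (Sym2 V)} (hM : IsMatching M) {e : Sym2 V} (he : e ∈ M)
    {v : V} (hv : v ∈ e) : contract M v = e := by
  have h : ∃ e ∈ M, v ∈ e := ⟨e, he, hv⟩
  rw [contract, dif_pos h]
  exact hM _ h.choose_spec.1 e he v h.choose_spec.2 hv

lemma contract_mem_or_eq (M : Finset (Sym2 V)) (v : V) :
    contract M v ∈ M ∨ contract M v = s(v, v) := by
  unfold contract
  split_ifs with h
  · exact .inl h.choose_spec.1
  · exact .inr rfl

lemma card_filter_map_contract_eq_le (M F : Finset (Sym2 V)) (z : Sym2 (Sym2 V)) :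
    (F.filter (Sym2.map (contract M) · = z)).card ≤ 4 := by
  induction z with | _ p q
  induction p with | _ a b
  induction q with | _ x y
  refine (card_le_card (t := {s(a, x), s(a, y), s(b, x), s(b, y)}) fun e he => ?_).trans card_le_four
  induction e with | _ u v
  have hu := mem_contract M u
  have hv := mem_contract M v
  rw [mem_filter, Sym2.map_mk, Sym2.eq_iff] at he
  obtain ⟨h₁, h₂⟩ | ⟨h₁, h₂⟩ := he.2 <;> rw [h₁, Sym2.mem_iff] at hu <;>
    rw [h₂, Sym2.mem_iff] at hv <;> obtain rfl | rfl := hu <;> obtain rfl | rfl := hv <;>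
    simp [Sym2.eq_swap]

lemma card_filter_mem_map_contract_le {M F : Finset (Sym2 V)} {d : ℕ}
    {z : Sym2 V} (hF : ∀ v ∈ z, (F.filter (v ∈ ·)).card ≤ d) :
    (F.filter (z ∈ Sym2.map (contract M) ·)).card ≤ 2 * d := by
  induction z with | _ a b
  have h : F.filter (s(a, b) ∈ Sym2.map (contract M) ·) ⊆
      F.filter (a ∈ ·) ∪ F.filter (b ∈ ·) := by
    intro e he
    obtain ⟨heF, he⟩ := mem_filter.1 he
    obtain ⟨v, hve, hv⟩ := Sym2.mem_map.1 he
    have := hv ▸ mem_contract M v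
    obtain rfl | rfl := Sym2.mem_iff.1 this <;> simp [heF, hve]
  have := (card_le_card h).trans (card_union_le _ _)
  have := hF a (by simp)
  have := hF b (by simp)
  omega

lemma card_filter_mem_map_contract_le_of_notMem {M F : Finset (Sym2 V)} {d : ℕ}
    (hF : ∀ v, (F.filter (v ∈ ·)).card ≤ d) {z : Sym2 V} (hz : z ∉ M) :
    (F.filter (z ∈ Sym2.map (contract M) ·)).card ≤ d := by
  induction z with | _ a b
  refine (card_le_card fun e he => ?_).trans (hF a)
  obtain ⟨heF, he⟩ := mem_filter.1 he
  obtain ⟨v, hve, hv⟩ := Sym2.mem_map.1 he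
  obtain h | h := contract_mem_or_eq M v
  · exact absurd (hv ▸ h) hz
  · rw [hv, Sym2.eq_iff] at h
    have : a = v := by tauto
    simp [heF, this, hve]

end Contraction

section Greedy

variable {V α : Type*} [DecidableEq V] [DecidableEq α]

/-- The colours of the edges of `F` at `v`. -/
def palette (F : Finset (Sym2 V)) (c : Sym2 V → α) (v : V) : Finset α :=
  (F.filter (v ∈ ·)).image c

lemma mem_palette {F : Finset (Sym2 V)} {c : Sym2 V → α} {v : V} {a : α} :
    a ∈ palette F c v ↔ ∃ e ∈ F, v ∈ e ∧ c e = a := by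
  simp [palette, and_assoc]

lemma palette_congr {F : Finset (Sym2 V)} {c c' : Sym2 V → α} (h : ∀ e ∈ F, c e = c' e) (v : V) :
    palette F c v = palette F c' v :=
  image_congr fun e he => h e (mem_filter.1 he).1

lemma Proper.card_palette {F : Finset (Sym2 V)} {c : Sym2 V → α} (hc : Proper id F c) (v : V) :
    (palette F c v).card = (F.filter (v ∈ ·)).card := by
  refine card_image_of_injOn fun e he f hf h => by_contra fun hef => ?_
  simp only [coe_filter, Set.mem_ofPred_eq] at he hf
  exact hc e he.1 f hf.1 hef v he.2 hf.2 h

lemma palette_insert_update {F : Finset (Sym2 V)} {c : Sym2 V → α} {e : Sym2 V} (he : e ∉ F) (a : α)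
    (v : V) : palette (insert e F) (Function.update c e a) v =
      if v ∈ e then insert a (palette F c v) else palette F c v := by
  have h := palette_congr (c := Function.update c e a) (c' := c)
    (fun f hf => Function.update_of_ne (ne_of_mem_of_not_mem hf he) _ _) v
  rw [palette, filter_insert]
  split_ifs with hv
  · rw [image_insert, Function.update_self, ← h, palette]
  · rw [← h, palette]

lemma exists_distinguishing_color [Fintype α] {F : Finset (Sym2 V)} (c : Sym2 V → α) {e : Sym2 V}
    {t : ℕ} (ht : ∀ v ∈ e, (F.filter (v ∈ ·)).card ≤ t) (hα : 4 * t < Fintype.card α) :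
    ∃ a, ∀ v ∈ e, a ∉ palette F c v ∧
      ∀ z, s(v, z) ∈ F → insert a (palette F c v) ≠ palette F c z := by
  classical
  let bad (v : V) (f : Sym2 V) : Finset α := univ.filter fun a => a ∉ palette F c v ∧
    ∃ z, f = s(v, z) ∧ insert a (palette F c v) = palette F c z
  have hbad : ∀ v f, (bad v f).card ≤ 1 := by
    intro v f
    refine card_le_one.2 fun a ha b hb => ?_
    simp only [bad, mem_filter, mem_univ, true_and] at ha hb
    obtain ⟨hav, z, rfl, haz⟩ := ha
    obtain ⟨hbv, z', hz', hbz⟩ := hb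
    obtain rfl := Sym2.congr_right.1 hz'
    have : a ∈ insert b (palette F c v) := by rw [hbz, ← haz]; exact mem_insert_self _ _
    exact (mem_insert.1 this).resolve_right hav
  let B (v : V) : Finset α := palette F c v ∪ (F.filter (v ∈ ·)).biUnion (bad v)
  have hB : ∀ v ∈ e, (B v).card ≤ 2 * t := by
    intro v hv
    have h₁ : (palette F c v).card ≤ _ := card_image_le
    have h₂ := card_biUnion_le_card_mul (F.filter (v ∈ ·)) (bad v) 1 fun f _ => hbad v f
    have h₃ := card_union_le (palette F c v) ((F.filter (v ∈ ·)).biUnion (bad v))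
    have := ht v hv
    simp only [B]
    omega
  induction e with | _ x y
  obtain ⟨a, -, ha⟩ : ∃ a ∈ univ, a ∉ B x ∪ B y := by
    refine exists_mem_notMem_of_card_lt_card ?_
    have := card_union_le (B x) (B y)
    have := hB x (by simp)
    have := hB y (by simp)
    rw [card_univ]
    omega
  refine ⟨a, fun v hv => ?_⟩
  have hav : a ∉ B v := by
    rw [mem_union, not_or] at ha
    obtain rfl | rfl := Sym2.mem_iff.1 hv
    exacts [ha.1, ha.2]
  have hav' : a ∉ palette F c v := fun h => hav (mem_union_left _ h)
  refine ⟨hav', fun z hz h => hav (mem_union_right _ (mem_biUnion.2 ⟨s(v, z), ?_, ?_⟩))⟩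
  · simp [hz]
  · exact mem_filter.2 ⟨mem_univ _, hav', z, rfl, h⟩

/-- Extending a proper colouring of `F` to `F ∪ M` so that the edges of `M` distinguish the ends of
every edge of `F` that they touch. -/
lemma Proper.exists_greedy_extension [Fintype α] {F : Finset (Sym2 V)} {c : Sym2 V → α}
    (hc : Proper id F c) (hF : ∀ e ∈ F, ¬ e.IsDiag) {t : ℕ} (hα : 4 * t < Fintype.card α)
    (M : Finset (Sym2 V)) (hFM : Disjoint F M)
    (ht : ∀ e ∈ M, ∀ v ∈ e, ((F ∪ M).filter (v ∈ ·)).card ≤ t) :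
    ∃ c' : Sym2 V → α, (∀ e ∈ F, c' e = c e) ∧ Proper id (F ∪ M) c' ∧
      ∀ u v, s(u, v) ∈ F → (∃ e ∈ M, u ∈ e ∨ v ∈ e) →
        palette (F ∪ M) c' u ≠ palette (F ∪ M) c' v := by
  induction M using Finset.induction_on with
  | empty => exact ⟨c, fun _ _ => rfl, by simpa using hc, by simp⟩
  | insert e M heM ih =>
    have heF : e ∉ F := disjoint_right.1 hFM (mem_insert_self _ _)
    have hsub : F ∪ M ⊆ F ∪ insert e M := union_subset_union_right (subset_insert _ _)
    have hmono : ∀ v, ((F ∪ M).filter (v ∈ ·)).card ≤ ((F ∪ insert e M).filter (v ∈ ·)).card :=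
      fun v => card_le_card (filter_subset_filter _ hsub)
    obtain ⟨c', hcc', hc', hdist⟩ := ih (hFM.mono_right (subset_insert _ _)) fun f hf v hv =>
      (hmono v).trans (ht f (mem_insert_of_mem hf) v hv)
    obtain ⟨a, ha⟩ := exists_distinguishing_color (F := F ∪ M) c' (e := e)
      (fun v hv => (hmono v).trans (ht e (mem_insert_self _ _) v hv)) hα
    have he : e ∉ F ∪ M := by simp [heF, heM]
    rw [union_insert]
    refine ⟨Function.update c' e a, fun f hf => ?_, hc'.update fun v hv f hf hvf h => ?_, ?_⟩
    · rw [Function.update_of_ne (ne_of_mem_of_not_mem hf heF), hcc' f hf]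
    · exact (ha v hv).1 (mem_palette.2 ⟨f, hf, hvf, h⟩)
    · intro u v huv hM
      have hnot : ¬ (u ∈ e ∧ v ∈ e) := fun h =>
        heF ((Sym2.mem_and_mem_iff fun h' => hF _ huv h').1 h ▸ huv)
      have huv' : s(u, v) ∈ F ∪ M := mem_union_left _ huv
      rw [palette_insert_update he, palette_insert_update he]
      split_ifs with hu hv hv
      · exact absurd ⟨hu, hv⟩ hnot
      · exact (ha u hu).2 v huv'
      · exact ((ha v hv).2 u (Sym2.eq_swap ▸ huv')).symm
      · refine hdist u v huv ?_
        obtain ⟨f, hf, huf⟩ := hM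
        obtain rfl | hf := mem_insert.1 hf
        · tauto
        · exact ⟨f, hf, huf⟩

end Greedy

section Main

variable {V α : Type*} [DecidableEq V] [DecidableEq α]

lemma Proper.weightAt_eq_sum_palette {F H : Finset (Sym2 V)} {c : Sym2 V → α}
    (hc : Proper id F c) (hHF : H ⊆ F) {w : Sym2 V → ℕ} {ω : α → ℕ}
    (hω : ∀ e ∈ F, ω (c e) = if e ∈ H then w e else 0) (v : V) :
    weightAt H w v = ∑ a ∈ palette F c v, ω a := by
  rw [palette, sum_image, weightAt]
  · rw [sum_congr rfl fun e he => hω e (mem_filter.1 he).1, ← sum_filter]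
    refine sum_congr ?_ fun _ _ => rfl
    ext e
    simp only [mem_filter]
    exact ⟨fun h => ⟨⟨hHF h.1, h.2⟩, h.1⟩, fun h => ⟨h.2, h.1.2⟩⟩
  · intro e he f hf h
    simp only [coe_filter, Set.mem_ofPred_eq] at he hf
    exact by_contra fun hef => hc e he.1 f hf.1 hef v he.2 hf.2 h

lemma card_filter_mem_edgeFinset [Fintype V] (G : SimpleGraph V) [DecidableRel G.Adj] (v : V) :
    (G.edgeFinset.filter (v ∈ ·)).card = G.degree v := by
  rw [← G.card_incidenceFinset_eq_degree, G.incidenceFinset_eq_filter]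

/-- For a suitable `b`, a graph of maximum degree at most `D` without isolated edges has an adjacent
vertex distinguishing edge colouring with `D + 64 * (D / b) + 132` colours. -/
theorem exists_avd_coloring [Fintype V] (G : SimpleGraph V) [DecidableRel G.Adj]
    (hG : ∀ u v, G.Adj u v → 1 < G.degree u ∨ 1 < G.degree v) {D b : ℕ} (hb : 0 < b)
    (hD : ∀ v, G.degree v ≤ D) (hDb : 4 * D < ((D / 8 + 1) / b + 1) ^ 2) :
    ∃ c : Sym2 V → Fin (D + 4) ⊕ (Fin 4 × Fin 4) × Fin (2 * (2 * (D / b + 1)) + 4),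
      Proper id G.edgeFinset c ∧
        ∀ u v, G.Adj u v → palette G.edgeFinset c u ≠ palette G.edgeFinset c v := by
  have hdeg := card_filter_mem_edgeFinset G
  obtain ⟨M, hML, hM, hmax⟩ :=
    exists_maximal_matching (G.edgeFinset.filter fun e => ∀ v ∈ e, G.degree v ≤ D / 8)
  have hME : M ⊆ G.edgeFinset := hML.trans (filter_subset _ _)
  have hlow : ∀ e ∈ M, ∀ v ∈ e, G.degree v ≤ D / 8 := fun e he => (mem_filter.1 (hML he)).2
  set F := G.edgeFinset \ M with hF
  have hFE : F ⊆ G.edgeFinset := sdiff_subset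
  have hFM : F ∪ M = G.edgeFinset := sdiff_union_of_subset hME
  have hdegF : ∀ v, (F.filter (v ∈ ·)).card ≤ G.degree v := fun v =>
    (card_le_card (filter_subset_filter _ hFE)).trans (hdeg v).le
  have hhigh : ∀ v, D / 8 < G.degree v → F.filter (v ∈ ·) = G.edgeFinset.filter (v ∈ ·) := by
    intro v hv
    refine (filter_subset_filter _ hFE).antisymm fun e he => ?_
    obtain ⟨heE, hve⟩ := mem_filter.1 he
    exact mem_filter.2 ⟨mem_sdiff.2 ⟨heE, fun heM => (hlow e heM v hve).not_gt hv⟩, hve⟩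
  obtain ⟨H, hHF, hH⟩ := exists_balanced_subset F hb
  have hP : ∀ v ∈ univ.filter fun v => D / 8 < G.degree v,
      4 * G.degree v < ((H.filter (v ∈ ·)).card + 1) ^ 2 := by
    intro v hv
    have hv := (mem_filter.1 hv).2
    have h₁ := (hH v).1
    rw [hhigh v hv, hdeg] at h₁
    have h₂ : (D / 8 + 1) / b ≤ (H.filter (v ∈ ·)).card := (Nat.div_le_div_right hv).trans h₁
    calc 4 * G.degree v ≤ 4 * D := Nat.mul_le_mul_left _ (hD v)
      _ < _ := hDb
      _ ≤ _ := Nat.pow_le_pow_left (by omega) 2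
  obtain ⟨w₁, w₂, hw₁, hw₂, hw⟩ := exists_weights G _ hP
  set l : Sym2 V → Fin 4 × Fin 4 := fun e =>
    if e ∈ H then (Fin.ofNat 4 (w₁ e), Fin.ofNat 4 (w₂ e)) else (0, 0) with hl
  have hlH : ∀ i, i ≠ (0, 0) → F.filter (l · = i) ⊆ H := by
    intro i hi e he
    obtain ⟨-, rfl⟩ := mem_filter.1 he
    by_contra h
    exact hi (by simp [hl, h])
  have hHd : ∀ v, (H.filter (v ∈ ·)).card ≤ 2 * (D / b + 1) := fun v =>
    (hH v).2.trans (by have := Nat.div_le_div_right (c := b) ((hdegF v).trans (hD v)); omega)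
  have hcardD : ∀ z, (F.filter (z ∈ Sym2.map (contract M) ·)).card ≤ D := by
    intro z
    by_cases hz : z ∈ M
    · have := card_filter_mem_map_contract_le (M := M) (F := F) (z := z) fun v hv =>
        (hdegF v).trans (hlow z hz v hv)
      omega
    · exact card_filter_mem_map_contract_le_of_notMem (fun v => (hdegF v).trans (hD v)) hz
  have hcards : ∀ i, i ≠ (0, 0) → ∀ z,
      (F.filter fun e => l e = i ∧ z ∈ Sym2.map (contract M) e).card ≤ 2 * (2 * (D / b + 1)) := by
    intro i hi z
    rw [← filter_filter]
    exact card_filter_mem_map_contract_le fun v _ =>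
      (card_le_card (filter_subset_filter _ (hlH i hi))).trans (hHd v)
  obtain ⟨c, hc, hcl⟩ := exists_proper_of_label (Sym2.map (contract M)) F l (0, 0)
    (by norm_num) hcardD hcards (card_filter_map_contract_eq_le M F)
  have hcF : Proper id F c := fun e he f hf hef v hve hvf =>
    hc e he f hf hef (contract M v) (Sym2.mem_map.2 ⟨v, hve, rfl⟩) (Sym2.mem_map.2 ⟨v, hvf, rfl⟩)
  obtain ⟨c', hcc', hc', hdist⟩ := hcF.exists_greedy_extension
    (fun e he => G.not_isDiag_of_mem_edgeFinset (hFE he)) (t := D / 8)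
    (by simp only [Fintype.card_sum, Fintype.card_fin]; omega) M sdiff_disjoint
    (fun e he v hv => by rw [hFM, hdeg]; exact hlow e he v hv)
  rw [hFM] at hc' hdist
  refine ⟨c', hc', fun u v huv h => ?_⟩
  have hdeguv : G.degree u = G.degree v := by
    rw [← hdeg u, ← hdeg v, ← hc'.card_palette, ← hc'.card_palette, h]
  by_cases hu : G.degree u ≤ D / 8
  · have huvL : s(u, v) ∈ G.edgeFinset.filter fun e => ∀ v ∈ e, G.degree v ≤ D / 8 := by
      simp [huv, hu, ← hdeguv]
    by_cases huvM : s(u, v) ∈ M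
    · obtain ⟨f, hf, hfuv⟩ : ∃ f ∈ G.edgeFinset.filter (u ∈ ·), f ≠ s(u, v) := by
        refine exists_mem_ne ?_ _
        have := hG u v huv
        rw [hdeg]
        omega
      obtain ⟨hfE, huf⟩ := mem_filter.1 hf
      have hnotM : ∀ g, g ≠ s(u, v) → ∀ x, x = u ∨ x = v → x ∈ g → g ∉ M := fun g hg x hx hxg hgM =>
        hg (hM g hgM _ huvM x hxg (Sym2.mem_iff.2 hx))
      have hfF : f ∈ F := mem_sdiff.2 ⟨hfE, hnotM f hfuv u (.inl rfl) huf⟩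
      have : c' f ∈ palette G.edgeFinset c' v := h ▸ mem_palette.2 ⟨f, hfE, huf, rfl⟩
      obtain ⟨g, hgE, hvg, hgf⟩ := mem_palette.1 this
      have hfg : f ≠ g := by
        rintro rfl
        exact hfuv ((Sym2.mem_and_mem_iff huv.ne).1 ⟨huf, hvg⟩)
      by_cases hguv : g = s(u, v)
      · exact hc' f hfE g hgE hfg u huf (by simp [hguv]) hgf.symm
      · have hgF : g ∈ F := mem_sdiff.2 ⟨hgE, hnotM g hguv v (.inr rfl) hvg⟩
        rw [hcc' g hgF, hcc' f hfF] at hgf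
        refine hc f hfF g hgF hfg s(u, v) ?_ ?_ hgf.symm
        · exact Sym2.mem_map.2 ⟨u, huf, hM.contract_eq huvM (by simp)⟩
        · exact Sym2.mem_map.2 ⟨v, hvg, hM.contract_eq huvM (by simp)⟩
    · obtain ⟨f, hf, x, hx, hxf⟩ := hmax _ huvL
      refine hdist u v (mem_sdiff.2 ⟨by simpa using huv, huvM⟩) ⟨f, hf, ?_⟩ h
      obtain rfl | rfl := Sym2.mem_iff.1 hx
      exacts [.inl hxf, .inr hxf]
  · have hu : D / 8 < G.degree u := not_le.1 hu
    have hpal : ∀ x, D / 8 < G.degree x → palette F c x = palette G.edgeFinset c' x := by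
      intro x hx
      rw [← palette_congr hcc', palette, hhigh x hx, palette]
    have hpuv : palette F c u = palette F c v := by
      rw [hpal u hu, hpal v (hdeguv ▸ hu), h]
    have hω : ∀ e ∈ H, w₁ e % 4 = w₁ e ∧ w₂ e % 4 = w₂ e := fun e he =>
      ⟨Nat.mod_eq_of_lt (Nat.lt_succ_of_le (hw₁.le_three e he)),
        Nat.mod_eq_of_lt (Nat.lt_succ_of_le (hw₂.le_three e he))⟩
    have h₁ := hcF.weightAt_eq_sum_palette hHF (w := w₁)
      (ω := fun a => (Sum.elim (fun _ => (0, 0)) Prod.fst a : Fin 4 × Fin 4).1) fun e he => by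
        simp only [hcl e he, hl]
        split_ifs with heH
        · exact (hω e heH).1
        · rfl
    have h₂ := hcF.weightAt_eq_sum_palette hHF (w := w₂)
      (ω := fun a => (Sum.elim (fun _ => (0, 0)) Prod.fst a : Fin 4 × Fin 4).2) fun e he => by
        simp only [hcl e he, hl]
        split_ifs with heH
        · exact (hω e heH).2
        · rfl
    refine hw u (by simpa using hu) v (by simpa [← hdeguv] using hu) huv ?_
    rw [h₁ u, h₁ v, h₂ u, h₂ v, hpuv]

lemma exists_avd_coloring_nat [Fintype V] (G : SimpleGraph V) [DecidableRel G.Adj]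
    (hG : ∀ u v, G.Adj u v → 1 < G.degree u ∨ 1 < G.degree v) {D : ℕ} (hD₀ : 1024 ≤ D)
    (hD : ∀ v, G.degree v ≤ D) :
    ∃ c : Sym2 V → ℕ, (G.edgeFinset.image c).card ≤ D + 8192 * Nat.sqrt D + 132 ∧
      Proper id G.edgeFinset c ∧
        ∀ u v, G.Adj u v → palette G.edgeFinset c u ≠ palette G.edgeFinset c v := by
  set r := Nat.sqrt D with hr
  have hr₁ : r * r ≤ D := Nat.sqrt_le D
  have hr₂ : D < (r + 1) * (r + 1) := Nat.lt_succ_sqrt D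
  have hr₃ : 32 ≤ r := Nat.le_sqrt.2 hD₀
  set b := r / 32 with hb
  have hb₁ : 32 * b ≤ r := Nat.mul_div_le r 32
  have hb₂ : r + 1 ≤ 64 * b := by omega
  have hb₀ : 0 < b := by omega
  have hDb₁ : 2 * r + 1 ≤ (D / 8 + 1) / b := by
    rw [Nat.le_div_iff_mul_le hb₀]
    have : (2 * r + 1) * b ≤ D / 8 := by
      rw [Nat.le_div_iff_mul_le (by norm_num)]
      nlinarith
    omega
  have hDb₂ : D / b ≤ 128 * r := by
    have : D / b ≤ 4096 * b := Nat.div_le_of_le_mul (by nlinarith)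
    omega
  obtain ⟨c, hc, hdist⟩ := exists_avd_coloring G hG hb₀ hD (by nlinarith)
  let φ := Fintype.equivFin (Fin (D + 4) ⊕ (Fin 4 × Fin 4) × Fin (2 * (2 * (D / b + 1)) + 4))
  have hφ : Function.Injective fun a => (φ a : ℕ) := Fin.val_injective.comp φ.injective
  refine ⟨fun e => φ (c e), ?_, fun e he f hf hef v hve hvf h =>
    hc e he f hf hef v hve hvf (hφ h), fun u v huv h => hdist u v huv ?_⟩
  · calc (G.edgeFinset.image fun e => (φ (c e) : ℕ)).card
        = ((G.edgeFinset.image c).image fun a => (φ a : ℕ)).card := by rw [image_image]; rfl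
      _ ≤ (G.edgeFinset.image c).card := card_image_le
      _ ≤ D + 4 + 4 * 4 * (2 * (2 * (D / b + 1)) + 4) := by
        simpa using card_le_univ (G.edgeFinset.image c)
      _ ≤ D + 8192 * r + 132 := by omega
  · refine image_injective hφ ?_
    simpa only [palette, image_image, Function.comp_def] using h

lemma max_add_sqrt_le {d : ℕ} (hd : 2 ≤ d) :
    ((max d 1024 + 8192 * Nat.sqrt (max d 1024) + 132 : ℕ) : ℝ) ≤
      d + 10 ^ 7 * Real.sqrt d * Real.log d ^ 4 := by
  obtain h | h := le_total d 1024
  · have h2 : (2 : ℝ) ≤ d := by exact_mod_cast hd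
    have hlog : 1 / 2 ≤ Real.log d := by
      have := Real.log_two_gt_d9
      have := Real.log_le_log (by norm_num) h2
      linarith
    have hsqrt : 1 ≤ Real.sqrt d := Real.one_le_sqrt.2 (by linarith)
    have hlog4 : (1 / 2) ^ 4 ≤ Real.log d ^ 4 := by gcongr
    have : 1 * (1 / 2) ^ 4 ≤ Real.sqrt d * Real.log d ^ 4 := by gcongr
    have h32 : Nat.sqrt 1024 = 32 := Nat.sqrt_eq 32
    rw [max_eq_right h, h32]
    norm_num at this ⊢
    linarith
  · have hd' : (1024 : ℝ) ≤ d := by exact_mod_cast h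
    have hlog : 1 ≤ Real.log d := by
      rw [Real.le_log_iff_exp_le (by linarith)]
      linarith [Real.exp_one_lt_d9]
    have hsqrt : 1 ≤ Real.sqrt d := Real.one_le_sqrt.2 (by linarith)
    have hsqrt' : (Nat.sqrt d : ℝ) ≤ Real.sqrt d := Real.nat_sqrt_le_real_sqrt
    have : Real.sqrt d * 1 ≤ Real.sqrt d * Real.log d ^ 4 := by
      gcongr
      exact one_le_pow₀ hlog
    rw [max_eq_left h]
    push_cast
    linarith

end Main

end AVD

/-- There is a constant `C > 0` such that every finite simple graph `G` of maximum
degree `Δ` without isolated edges admits an adjacent vertex distinguishing edge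
colouring using at most `Δ + C·Δ^(1/2)·(log Δ)^4` colours, i.e.
`χ'_a(G) ≤ Δ + C·Δ^(1/2)·(log Δ)^4`. -/
theorem avd_edge_chromatic_bound :
    ∃ C : ℝ, 0 < C ∧
      ∀ (V : Type) [Fintype V] [DecidableEq V]
        (G : SimpleGraph V) [DecidableRel G.Adj],
        -- no isolated edges
        (∀ u v : V, G.Adj u v → 1 < G.degree u ∨ 1 < G.degree v) →
        ∃ c : Sym2 V → ℕ,
          -- at most Δ + C·Δ^(1/2)·(log Δ)^4 colours are used
          (((G.edgeFinset.image c).card : ℝ) ≤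
            (G.maxDegree : ℝ) + C * Real.sqrt (G.maxDegree) * (Real.log (G.maxDegree)) ^ 4) ∧
          -- proper edge colouring
          (∀ e ∈ G.edgeFinset, ∀ f ∈ G.edgeFinset,
            e ≠ f → (∃ w : V, w ∈ e ∧ w ∈ f) → c e ≠ c f) ∧
          -- adjacent vertices have distinct palettes
          (∀ u v : V, G.Adj u v →
            (G.incidenceFinset u).image c ≠ (G.incidenceFinset v).image c) := by
  refine ⟨10 ^ 7, by norm_num, fun V _ _ G _ hG => ?_⟩
  obtain ⟨c, hcard, hc, hdist⟩ := AVD.exists_avd_coloring_nat G hG (le_max_right G.maxDegree 1024)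
    fun v => (G.degree_le_maxDegree v).trans (le_max_left _ _)
  refine ⟨c, ?_, fun e he f hf hef ⟨v, hve, hvf⟩ => hc e he f hf hef v hve hvf,
    fun u v huv h => hdist u v huv ?_⟩
  · by_cases hΔ : 2 ≤ G.maxDegree
    · exact (Nat.cast_le.2 hcard).trans (AVD.max_add_sqrt_le hΔ)
    · have : G.edgeFinset = ∅ := by
        refine Finset.eq_empty_of_forall_notMem fun e he => ?_
        induction e with | _ u v
        have := G.degree_le_maxDegree u
        have := G.degree_le_maxDegree v
        have := hG u v (by simpa using he)
        omega
      rw [this, Finset.image_empty, Finset.card_empty, Nat.cast_zero]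
      positivity
  · simpa only [AVD.palette, ← G.incidenceFinset_eq_filter] using h
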